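/- arXiv:1510.07269 — 5 statements merged into one kernel-verified Lean document; each statement's English description precedes it below -/
import Mathlib

section
/- Let m ≥ 1 and n ≥ 2 be integers, let D be the closed unit ball in ℝ^m, let h : ℝ^m → ℝ be a smooth function, and let η ∈ ℝ satisfy Δh(x) > η for all x ∈ D. Let u : ℝ^m → ℝ be a C^n function with u(x) = h(x) for all x outside the open unit ball and Δu(x) ≥ η for all x ∈ D. Then for every δ > 0 there exists a smooth function w : ℝ^m → ℝ such that w(x) = h(x) for all x outside the open unit ball, Δw(x) ≥ η for all x ∈ D, and sup_{x ∈ ℝ^m} max_{0 ≤ k ≤ n} ‖D^k(w − u)(x)‖ < δ, where D^k denotes the k-th total (iterated Fréchet) derivative. (That is, smooth functions satisfying the constraints are dense, in the uniform C^n sense, among C^n functions satisfying them.) -/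
/-- The Euclidean Laplacian of `u : ℝᵐ → ℝ`. -/
noncomputable def euclideanLaplacian {m : ℕ} (u : EuclideanSpace ℝ (Fin m) → ℝ)
    (x : EuclideanSpace ℝ (Fin m)) : ℝ :=
  ∑ i : Fin m,
    iteratedFDeriv ℝ 2 u x (fun _ => EuclideanSpace.single i (1 : ℝ))

open Filter Topology MeasureTheory
open scoped Convolution ContDiff

section Approximation

variable {E F : Type*} [NormedAddCommGroup E] [NormedSpace ℝ E]
  [NormedAddCommGroup F] [NormedSpace ℝ F]

/-- Derivatives of a function precomposed with a homothety. -/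
lemma iteratedFDeriv_comp_smul {k : ℕ} {f : E → F} (hf : ContDiff ℝ k f) (c : ℝ) (x : E) :
    iteratedFDeriv ℝ k (fun y => f (c • y)) x = c ^ k • iteratedFDeriv ℝ k f (c • x) := by
  have h := (c • ContinuousLinearMap.id ℝ E).iteratedFDeriv_comp_right hf x le_rfl
  ext v
  have hv := congrArg (fun A => A v) h
  simpa [Function.comp_def, ContinuousMultilinearMap.map_smul_univ] using hv

/-- A `C^k` function vanishing outside the unit ball is approximated in `C^k` by its
compressions `x ↦ f (c • x)`, as `c` decreases to `1`. -/
lemma eventually_norm_iteratedFDeriv_comp_smul_sub_lt [ProperSpace E] {k : ℕ} {f : E → F}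
    (hf : ContDiff ℝ k f) (hf0 : ∀ x ∉ Metric.ball (0 : E) 1, f x = 0) {ε : ℝ} (hε : 0 < ε) :
    ∀ᶠ c : ℝ in 𝓝[>] 1, ∀ x,
      ‖iteratedFDeriv ℝ k (fun y => f (c • y) - f y) x‖ < ε := by
  have hsupp : tsupport f ⊆ Metric.closedBall 0 1 := by
    refine closure_minimal (fun x hx => ?_) Metric.isClosed_closedBall
    by_contra hx'
    exact hx (hf0 x fun h => hx' (Metric.ball_subset_closedBall h))
  have hzero : ∀ x ∉ Metric.closedBall (0 : E) 1, iteratedFDeriv ℝ k f x = 0 := fun x hx => by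
    by_contra h
    exact hx (hsupp (support_iteratedFDeriv_subset k h))
  have hcont : Continuous (iteratedFDeriv ℝ k f) := hf.continuous_iteratedFDeriv le_rfl
  have hK : ∀ᶠ c : ℝ in 𝓝 1, ∀ x ∈ Metric.closedBall (0 : E) 1,
      ‖c ^ k • iteratedFDeriv ℝ k f (c • x) - iteratedFDeriv ℝ k f x‖ < ε := by
    refine (isCompact_closedBall (0 : E) 1).eventually_forall_of_forall_eventually fun x _ => ?_
    have hc : Continuous fun z : ℝ × E =>
        ‖z.1 ^ k • iteratedFDeriv ℝ k f (z.1 • z.2) - iteratedFDeriv ℝ k f z.2‖ := by fun_prop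
    refine hc.continuousAt.eventually_lt continuousAt_const ?_
    simpa using hε
  filter_upwards [nhdsWithin_le_nhds hK, self_mem_nhdsWithin] with c hc hc1 x
  have hcd : ContDiff ℝ k fun y => f (c • y) := hf.comp (contDiff_const_smul c)
  rw [fun_iteratedFDeriv_sub_apply hcd.contDiffAt hf.contDiffAt, iteratedFDeriv_comp_smul hf]
  by_cases hx : x ∈ Metric.closedBall (0 : E) 1
  · exact hc x hx
  · have hcx : c • x ∉ Metric.closedBall (0 : E) 1 := by
      have hc1' : (1 : ℝ) < c := hc1
      simp only [mem_closedBall_zero_iff, not_le, norm_smul, Real.norm_eq_abs] at hx ⊢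
      rw [abs_of_pos (by linarith)]
      nlinarith
    simpa [hzero _ hx, hzero _ hcx] using hε

end Approximation

universe u

section Mollification

variable {E : Type u} [NormedAddCommGroup E] [NormedSpace ℝ E] [FiniteDimensional ℝ E]
  [MeasurableSpace E] [BorelSpace E]

/-- Mollifications of a compactly supported `C^k` function converge to it in `C^k`. -/
lemma eventually_norm_iteratedFDeriv_normed_convolution_sub_le
    (μ : Measure E) [μ.IsAddHaarMeasure] (k : ℕ) {ε : ℝ} (hε : 0 < ε) :
    ∀ {F : Type u} [NormedAddCommGroup F] [NormedSpace ℝ F] [CompleteSpace F] {f : E → F},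
      ContDiff ℝ k f → HasCompactSupport f →
      ∀ᶠ r : ℝ in 𝓝[>] 0, ∀ φ : ContDiffBump (0 : E), φ.rOut = r → ∀ x,
        ‖iteratedFDeriv ℝ k
          (fun y => (φ.normed μ ⋆[ContinuousLinearMap.lsmul ℝ ℝ, μ] f) y - f y) x‖ ≤ ε := by
  induction k with
  | zero =>
    intro F _ _ _ f hf hfc
    have huc := hfc.uniformContinuous_of_continuous hf.continuous
    obtain ⟨d, hd, hdf⟩ := Metric.uniformContinuous_iff.1 huc ε hε
    filter_upwards [Ioo_mem_nhdsGT hd] with r hr φ hφ x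
    rw [norm_iteratedFDeriv_zero, ← dist_eq_norm]
    refine φ.dist_normed_convolution_le hf.continuous.aestronglyMeasurable fun y hy => ?_
    exact (hdf ((Metric.mem_ball.1 hy).trans (hφ ▸ hr.2))).le
  | succ k ih =>
    intro F _ _ _ f hf hfc
    have hf1 : ContDiff ℝ 1 f := hf.of_le (by exact_mod_cast Nat.le_add_left 1 k)
    have hf' : ContDiff ℝ k (fderiv ℝ f) := hf.fderiv_right (by norm_cast)
    filter_upwards [ih hf' (hfc.fderiv ℝ)] with r hr φ hφ x
    rw [← norm_iteratedFDeriv_fderiv]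
    have hfd : fderiv ℝ
        (fun y => (φ.normed μ ⋆[ContinuousLinearMap.lsmul ℝ ℝ, μ] f) y - f y) =
        fun y => (φ.normed μ ⋆[ContinuousLinearMap.lsmul ℝ ℝ, μ] fderiv ℝ f) y
          - fderiv ℝ f y := by
      funext y
      have h1 := hfc.hasFDerivAt_convolution_right (μ := μ) (ContinuousLinearMap.lsmul ℝ ℝ)
        (φ.continuous_normed (μ := μ)).locallyIntegrable hf1 y
      exact (h1.sub (hf1.differentiable one_ne_zero y).hasFDerivAt).fderiv
    rw [hfd]
    exact hr φ hφ x

end Mollification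

/-- A `C^n` function vanishing outside the open unit ball is approximated in `C^n` by smooth
functions vanishing outside the open unit ball. -/
lemma exists_contDiff_norm_iteratedFDeriv_sub_lt {E F : Type u} [NormedAddCommGroup E]
    [NormedSpace ℝ E] [FiniteDimensional ℝ E] [NormedAddCommGroup F] [NormedSpace ℝ F]
    [CompleteSpace F] {n : ℕ} {f : E → F} (hf : ContDiff ℝ n f)
    (hf0 : ∀ x ∉ Metric.ball (0 : E) 1, f x = 0) {ε : ℝ} (hε : 0 < ε) :
    ∃ g : E → F, ContDiff ℝ ∞ g ∧ (∀ x ∉ Metric.ball (0 : E) 1, g x = 0) ∧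
      ∀ x, ∀ k ≤ n, ‖iteratedFDeriv ℝ k (fun y => g y - f y) x‖ < ε := by
  borelize E
  let μ : Measure E := Measure.addHaar
  have hk : ∀ k ≤ n, ContDiff ℝ k f := fun k hk => hf.of_le (by exact_mod_cast hk)
  obtain ⟨c, hc, hc1⟩ := (((Set.finite_Iic n).eventually_all.2 fun k hkn =>
    eventually_norm_iteratedFDeriv_comp_smul_sub_lt (hk k hkn) hf0 (half_pos hε)).and
      self_mem_nhdsWithin).exists
  replace hc1 : 1 < c := hc1
  have hc0 : 0 < c := by linarith
  set fc : E → F := fun y => f (c • y) with hfc_def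
  have hfc : ContDiff ℝ n fc := hf.comp (contDiff_const_smul c)
  have hfc0 : ∀ x, c⁻¹ < ‖x‖ → fc x = 0 := fun x hx => hf0 _ fun h => by
    rw [mem_ball_zero_iff, norm_smul, Real.norm_of_nonneg hc0.le] at h
    have := mul_lt_mul_of_pos_left hx hc0
    rw [mul_inv_cancel₀ hc0.ne'] at this
    linarith
  have hfcc : HasCompactSupport fc := HasCompactSupport.intro (isCompact_closedBall (0 : E) c⁻¹)
    fun x hx => hfc0 x (by simpa using hx)
  have hfck : ∀ k ≤ n, ContDiff ℝ k fc := fun k hk => hfc.of_le (by exact_mod_cast hk)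
  have hgap : 0 < 1 - c⁻¹ := sub_pos.2 (inv_lt_one_of_one_lt₀ hc1)
  obtain ⟨r, hr, hr0, hr1⟩ := (((Set.finite_Iic n).eventually_all.2 fun k hkn =>
    eventually_norm_iteratedFDeriv_normed_convolution_sub_le μ k (half_pos hε)
      (hfck k hkn) hfcc).and (Ioo_mem_nhdsGT hgap)).exists
  let φ : ContDiffBump (0 : E) := ⟨r / 2, r, half_pos hr0, half_lt_self hr0⟩
  set g : E → F := φ.normed μ ⋆[ContinuousLinearMap.lsmul ℝ ℝ, μ] fc with hg_def
  have hg : ContDiff ℝ ∞ g := φ.hasCompactSupport_normed.contDiff_convolution_left _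
    φ.contDiff_normed hfc.continuous.locallyIntegrable
  refine ⟨g, hg, fun x hx => ?_, fun x k hkn => ?_⟩
  · by_contra hgx
    obtain ⟨a, ha, b, hb, rfl⟩ := support_convolution_subset _ hgx
    rw [φ.support_normed_eq, mem_ball_zero_iff] at ha
    have hb' : ‖b‖ ≤ c⁻¹ := not_lt.1 fun h => hb (hfc0 b h)
    refine hx (mem_ball_zero_iff.2 ((norm_add_le a b).trans_lt ?_))
    have ha' : ‖a‖ < r := ha
    linarith
  · have hgk : ContDiff ℝ k g := hg.of_le (by exact_mod_cast le_top)
    have hsum : (fun y => g y - f y) = fun y => (g y - fc y) + (fc y - f y) := by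
      funext y; abel
    rw [hsum, fun_iteratedFDeriv_add_apply (hgk.sub (hfck k hkn)).contDiffAt
      ((hfck k hkn).sub (hk k hkn)).contDiffAt]
    refine (norm_add_le _ _).trans_lt ?_
    have h1 := hr k hkn φ rfl x
    have h2 := hc k hkn x
    linarith

section Laplacian

variable {m : ℕ} {f g : EuclideanSpace ℝ (Fin m) → ℝ}

lemma euclideanLaplacian_add (hf : ContDiff ℝ 2 f) (hg : ContDiff ℝ 2 g)
    (x : EuclideanSpace ℝ (Fin m)) :
    euclideanLaplacian (fun y => f y + g y) x =
      euclideanLaplacian f x + euclideanLaplacian g x := by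
  simp only [euclideanLaplacian]
  rw [fun_iteratedFDeriv_add_apply hf.contDiffAt hg.contDiffAt]
  simp [Finset.sum_add_distrib]

lemma euclideanLaplacian_const_mul (hf : ContDiff ℝ 2 f) (a : ℝ)
    (x : EuclideanSpace ℝ (Fin m)) :
    euclideanLaplacian (fun y => a * f y) x = a * euclideanLaplacian f x := by
  have h := iteratedFDeriv_const_smul_apply' (a := a) (hf.contDiffAt (x := x))
  simp only [smul_eq_mul] at h
  simp only [euclideanLaplacian]
  rw [h]
  simp [Finset.mul_sum]

lemma abs_euclideanLaplacian_le (f : EuclideanSpace ℝ (Fin m) → ℝ)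
    (x : EuclideanSpace ℝ (Fin m)) :
    |euclideanLaplacian f x| ≤ m * ‖iteratedFDeriv ℝ 2 f x‖ := by
  refine (Finset.abs_sum_le_sum_abs _ _).trans ?_
  refine (Finset.sum_le_card_nsmul _ _ ‖iteratedFDeriv ℝ 2 f x‖ fun i _ => ?_).trans (by simp)
  simpa using (iteratedFDeriv ℝ 2 f x).le_opNorm fun _ => EuclideanSpace.single i (1 : ℝ)

lemma continuous_euclideanLaplacian (hf : ContDiff ℝ 2 f) :
    Continuous (euclideanLaplacian f) := by
  have h : Continuous (iteratedFDeriv ℝ 2 f) := hf.continuous_iteratedFDeriv le_rfl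
  unfold euclideanLaplacian
  fun_prop

end Laplacian

/-- Smooth functions which agree with a background smooth function `h` outside
the open unit ball and satisfy `Δ ≥ η` on the closed unit ball `D` are dense
(in the uniform `C^n` sense) among `C^n` functions satisfying the same
constraints, provided `Δh > η` on `D`. -/
theorem smooth_dense_in_constrained_Cn {m n : ℕ} (hm : 1 ≤ m) (hn : 2 ≤ n)
    (h : EuclideanSpace ℝ (Fin m) → ℝ) (hsmooth : ContDiff ℝ (⊤ : ℕ∞) h) (η : ℝ)
    (hΔh : ∀ x ∈ Metric.closedBall (0 : EuclideanSpace ℝ (Fin m)) 1,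
      η < euclideanLaplacian h x)
    (u : EuclideanSpace ℝ (Fin m) → ℝ) (hu : ContDiff ℝ n u)
    (huh : ∀ x ∉ Metric.ball (0 : EuclideanSpace ℝ (Fin m)) 1, u x = h x)
    (hΔu : ∀ x ∈ Metric.closedBall (0 : EuclideanSpace ℝ (Fin m)) 1,
      η ≤ euclideanLaplacian u x)
    (δ : ℝ) (hδ : 0 < δ) :
    ∃ w : EuclideanSpace ℝ (Fin m) → ℝ, ContDiff ℝ (⊤ : ℕ∞) w ∧
      (∀ x ∉ Metric.ball (0 : EuclideanSpace ℝ (Fin m)) 1, w x = h x) ∧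
      (∀ x ∈ Metric.closedBall (0 : EuclideanSpace ℝ (Fin m)) 1,
        η ≤ euclideanLaplacian w x) ∧
      (∀ x, ∀ k ≤ n,
        ‖iteratedFDeriv ℝ k (fun y => w y - u y) x‖ < δ) := by
  have hhn : ContDiff ℝ n h := hsmooth.of_le (mod_cast le_top)
  have hn2 : (2 : WithTop ℕ∞) ≤ n := by exact_mod_cast hn
  have hh2 := hhn.of_le hn2
  set p : EuclideanSpace ℝ (Fin m) → ℝ := fun y => u y - h y with hp_def
  have hp : ContDiff ℝ n p := hu.sub hhn
  have hp0 : ∀ x ∉ Metric.ball (0 : EuclideanSpace ℝ (Fin m)) 1, p x = 0 := fun x hx =>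
    sub_eq_zero.2 (huh x hx)
  have hpc : HasCompactSupport p := HasCompactSupport.intro
    (isCompact_closedBall (0 : EuclideanSpace ℝ (Fin m)) 1)
    fun x hx => hp0 x fun h => hx (Metric.ball_subset_closedBall h)
  -- strictness of the inequality for `h`, uniformly on the closed ball
  obtain ⟨c, hc, hch⟩ : ∃ c > 0,
      ∀ x ∈ Metric.closedBall (0 : EuclideanSpace ℝ (Fin m)) 1,
        η + c ≤ euclideanLaplacian h x := by
    obtain ⟨x₀, hx₀, hmin⟩ :=
      (isCompact_closedBall (0 : EuclideanSpace ℝ (Fin m)) 1).exists_isMinOn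
        ⟨0, by simp⟩ (continuous_euclideanLaplacian hh2).continuousOn
    exact ⟨euclideanLaplacian h x₀ - η, sub_pos.2 (hΔh x₀ hx₀), fun x hx => by
      simpa using hmin hx⟩
  -- a common bound for the derivatives of `u - h`
  obtain ⟨M, hM0, hM⟩ : ∃ M > 0, ∀ k ≤ n, ∀ x, ‖iteratedFDeriv ℝ k p x‖ ≤ M := by
    have hb : ∀ k ∈ Set.Iic n, ∀ᶠ M : ℝ in atTop, ∀ x, ‖iteratedFDeriv ℝ k p x‖ ≤ M := by
      intro k hk
      obtain ⟨C, hC⟩ := (hp.continuous_iteratedFDeriv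
        (by exact_mod_cast hk)).bounded_above_of_compact_support (hpc.iteratedFDeriv k)
      filter_upwards [eventually_ge_atTop C] with M hM x using (hC x).trans hM
    obtain ⟨M, hM, hM0⟩ := (((Set.finite_Iic n).eventually_all.2 hb).and
      (eventually_gt_atTop 0)).exists
    exact ⟨M, hM0, hM⟩
  obtain ⟨t, ht0, ht1, htM⟩ : ∃ t : ℝ, 0 < t ∧ t ≤ 1 ∧ t * M ≤ δ / 2 := by
    refine ⟨min 1 (δ / 2 / M), by positivity, min_le_left _ _, ?_⟩
    rw [← le_div_iff₀ hM0]
    exact min_le_right _ _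
  have hm0 : (0 : ℝ) < m := by exact_mod_cast hm
  obtain ⟨ε, hε0, hεδ, hεm⟩ : ∃ ε : ℝ, 0 < ε ∧ ε ≤ δ / 2 ∧ m * ε ≤ t * c := by
    refine ⟨min (δ / 2) (t * c / m), by positivity, min_le_left _ _, ?_⟩
    rw [mul_comm, ← le_div_iff₀ hm0]
    exact min_le_right _ _
  obtain ⟨q, hq, hq0, hqp⟩ := exists_contDiff_norm_iteratedFDeriv_sub_lt hp hp0 hε0
  have hqn : ContDiff ℝ n q := hq.of_le (by exact_mod_cast le_top)
  have hd : ContDiff ℝ n fun y => q y - p y := hqn.sub hp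
  refine ⟨fun y => h y + (1 - t) * q y, hsmooth.add (contDiff_const.mul hq), fun x hx => ?_,
    fun x hx => ?_, fun x k hk => ?_⟩
  · simp [hq0 x hx]
  · have hw : (fun y => h y + (1 - t) * q y) =
        fun y => (t * h y + (1 - t) * u y) + (1 - t) * (q y - p y) := by
      funext y; simp only [hp_def]; ring
    have hu2 := hu.of_le hn2
    have hd2 := hd.of_le hn2
    rw [hw, euclideanLaplacian_add
      ((contDiff_const.mul hh2).add (contDiff_const.mul hu2)) (contDiff_const.mul hd2),
      euclideanLaplacian_add (contDiff_const.mul hh2) (contDiff_const.mul hu2),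
      euclideanLaplacian_const_mul hh2, euclideanLaplacian_const_mul hu2,
      euclideanLaplacian_const_mul hd2]
    have h1 := mul_le_mul_of_nonneg_left (hch x hx) ht0.le
    have h2 := mul_le_mul_of_nonneg_left (hΔu x hx) (sub_nonneg.2 ht1)
    have h3 : |euclideanLaplacian (fun y => q y - p y) x| ≤ m * ε :=
      (abs_euclideanLaplacian_le _ x).trans
        (mul_le_mul_of_nonneg_left (hqp x 2 hn).le hm0.le)
    have h4 := (abs_le.1 h3).1
    have hmε : 0 ≤ m * ε := by positivity
    have h5 := mul_le_mul_of_nonneg_left h4 (sub_nonneg.2 ht1)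
    nlinarith
  · have hkn : (k : WithTop ℕ∞) ≤ n := by exact_mod_cast hk
    have hw : (fun y => h y + (1 - t) * q y - u y) =
        fun y => (1 - t) • (q y - p y) + (-t) • p y := by
      funext y; simp only [hp_def, smul_eq_mul]; ring
    have hdk := hd.of_le hkn
    have hpk := hp.of_le hkn
    rw [hw, fun_iteratedFDeriv_add_apply (hdk.const_smul _).contDiffAt
      (hpk.const_smul _).contDiffAt, iteratedFDeriv_const_smul_apply' hdk.contDiffAt,
      iteratedFDeriv_const_smul_apply' hpk.contDiffAt]
    refine (norm_add_le _ _).trans_lt ?_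
    rw [norm_smul, norm_smul, norm_neg, Real.norm_of_nonneg ht0.le,
      Real.norm_of_nonneg (sub_nonneg.2 ht1)]
    have h1 := hqp x k hk
    have h2 := mul_le_mul_of_nonneg_left (hM k hk x) ht0.le
    have h3 := norm_nonneg (iteratedFDeriv ℝ k (fun y => q y - p y) x)
    nlinarith
end

section
/- Let m ≥ 1 and n ≥ 0 be integers and let v : ℝ^m → ℝ be a C^n function with v(x) = 0 for all x outside the open unit ball. Suppose that for each ε ∈ (0,1) a smooth function χ_ε : ℝ^m → ℝ is given with 0 ≤ χ_ε ≤ 1, with χ_ε(x) = 0 whenever |x| ≤ 1 − ε, and such that there is a constant C > 0 (independent of ε) with ‖D^k χ_ε(x)‖ ≤ C·ε^{−k} for all x ∈ ℝ^m and all integers 0 ≤ k ≤ n. Then sup_{|x| ≤ 1} max_{0 ≤ k ≤ n} ‖D^k(χ_ε · v)(x)‖ → 0 as ε → 0⁺. -/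
/-- The distance from a nonzero point of the unit ball to its radial projection on the sphere. -/
theorem norm_sub_inv_norm_smul_self {E : Type*} [NormedAddCommGroup E] [NormedSpace ℝ E] {x : E}
    (hx0 : 0 < ‖x‖) (hx1 : ‖x‖ ≤ 1) : ‖x - ‖x‖⁻¹ • x‖ = 1 - ‖x‖ := by
  have h : x - ‖x‖⁻¹ • x = (1 - ‖x‖⁻¹) • x := by rw [sub_smul, one_smul]
  rw [h, norm_smul, Real.norm_of_nonpos (by linarith [(one_le_inv₀ hx0).2 hx1])]
  field_simp
  ring

/-- All derivatives of order at most `n` of a `C^n` function vanishing off the open unit ball vanish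
off the open unit ball. -/
theorem iteratedFDeriv_eq_zero_of_one_le_norm {E F : Type*} [NormedAddCommGroup E]
    [NormedSpace ℝ E] [NormedAddCommGroup F] [NormedSpace ℝ F] {n k : ℕ} {v : E → F}
    (hv : ContDiff ℝ n v) (hv0 : ∀ x ∉ Metric.ball (0 : E) 1, v x = 0) (hk : k ≤ n)
    {x : E} (hx : 1 ≤ ‖x‖) : iteratedFDeriv ℝ k v x = 0 := by
  have hcont : Continuous fun x => iteratedFDeriv ℝ k v x :=
    hv.continuous_iteratedFDeriv (by exact_mod_cast hk)
  have hsub : closure (Metric.closedBall (0 : E) 1)ᶜ ⊆ {x | iteratedFDeriv ℝ k v x = 0} := by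
    refine closure_minimal (fun y hy => ?_) (isClosed_eq hcont continuous_const)
    have hev : v =ᶠ[nhds y] fun _ => 0 := by
      filter_upwards [Metric.isClosed_closedBall.isOpen_compl.mem_nhds hy] with z hz
      exact hv0 z fun h => hz (Metric.ball_subset_closedBall h)
    simpa using (hev.iteratedFDeriv ℝ k).eq_of_nhds
  apply hsub
  rw [closure_compl, interior_closedBall _ one_ne_zero]
  simpa using hx

/-- A `C^n` function vanishing off the open unit ball has `n`-th derivative uniformly small near the
unit sphere. -/
theorem exists_norm_iteratedFDeriv_le_near_sphere {E F : Type*} [NormedAddCommGroup E]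
    [NormedSpace ℝ E] [ProperSpace E] [NormedAddCommGroup F] [NormedSpace ℝ F] {n : ℕ} {v : E → F}
    (hv : ContDiff ℝ n v) (hv0 : ∀ x ∉ Metric.ball (0 : E) 1, v x = 0) {η : ℝ} (hη : 0 < η) :
    ∃ ε₀ ∈ Set.Ioo (0 : ℝ) 1, ∀ x : E, 1 - ε₀ < ‖x‖ → ‖iteratedFDeriv ℝ n v x‖ ≤ η := by
  have hsupp : HasCompactSupport v :=
    HasCompactSupport.intro (isCompact_closedBall (0 : E) 1)
      fun x hx => hv0 x fun h => hx (Metric.ball_subset_closedBall h)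
  have huc : UniformContinuous (iteratedFDeriv ℝ n v) :=
    (hsupp.iteratedFDeriv n).uniformContinuous_of_continuous (hv.continuous_iteratedFDeriv le_rfl)
  obtain ⟨r, hr, hclose⟩ := Metric.uniformContinuous_iff.1 huc η hη
  refine ⟨min r (1 / 2), ⟨by positivity, by linarith [min_le_right r (1 / 2)]⟩, fun x hx => ?_⟩
  rcases le_or_gt 1 ‖x‖ with h1 | h1
  · simp [iteratedFDeriv_eq_zero_of_one_le_norm hv hv0 le_rfl h1, hη.le]
  have hx0 : 0 < ‖x‖ := by linarith [min_le_right r (1 / 2)]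
  have hy : ‖‖x‖⁻¹ • x‖ = 1 := norm_smul_inv_norm (𝕜 := ℝ) (norm_pos_iff.1 hx0)
  have hdist : dist x (‖x‖⁻¹ • x) < r := by
    rw [dist_eq_norm, norm_sub_inv_norm_smul_self hx0 h1.le]
    linarith [min_le_left r (1 / 2)]
  have := hclose hdist
  rw [iteratedFDeriv_eq_zero_of_one_le_norm hv hv0 le_rfl hy.ge, dist_zero_right] at this
  exact this.le

/-- If the `n`-th derivative of `v` is bounded by `η` on the annulus `1 - ε ≤ ‖x‖ ≤ 1`, then the
derivative of order `n - j` is bounded there by `η * ε ^ j`. -/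
theorem norm_iteratedFDeriv_le_mul_pow_on_annulus {E F : Type*} [NormedAddCommGroup E]
    [NormedSpace ℝ E] [NormedAddCommGroup F] [NormedSpace ℝ F] {n : ℕ} {v : E → F}
    (hv : ContDiff ℝ n v) (hv0 : ∀ x ∉ Metric.ball (0 : E) 1, v x = 0) {η ε : ℝ} (hη : 0 ≤ η)
    (hε : ε ∈ Set.Ioo (0 : ℝ) 1)
    (hn : ∀ x : E, 1 - ε ≤ ‖x‖ → ‖x‖ ≤ 1 → ‖iteratedFDeriv ℝ n v x‖ ≤ η) (j : ℕ) :
    ∀ k, k + j = n → ∀ x : E, 1 - ε ≤ ‖x‖ → ‖x‖ ≤ 1 →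
      ‖iteratedFDeriv ℝ k v x‖ ≤ η * ε ^ j := by
  induction j with
  | zero =>
    rintro k rfl x hx hx1
    simpa using hn x hx hx1
  | succ j ih =>
    intro k hk x hx hx1
    have hx0 : 0 < ‖x‖ := by linarith [hε.2]
    have hy : ‖‖x‖⁻¹ • x‖ = 1 := norm_smul_inv_norm (𝕜 := ℝ) (norm_pos_iff.1 hx0)
    have hbound : ∀ z ∈ segment ℝ (‖x‖⁻¹ • x) x,
        ‖fderiv ℝ (iteratedFDeriv ℝ k v) z‖ ≤ η * ε ^ j := by
      rintro z ⟨a, b, ha, hb, hab, rfl⟩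
      rw [norm_fderiv_iteratedFDeriv]
      have hz : ‖a • ‖x‖⁻¹ • x + b • x‖ = a + b * ‖x‖ := by
        rw [smul_smul, ← add_smul, norm_smul, Real.norm_of_nonneg (by positivity)]
        field_simp
      apply ih (k + 1) (by omega) <;> rw [hz] <;> nlinarith
    have hdiff : Differentiable ℝ (iteratedFDeriv ℝ k v) :=
      hv.differentiable_iteratedFDeriv (by exact_mod_cast (by omega : k < n))
    have hmv := (convex_segment (‖x‖⁻¹ • x) x).norm_image_sub_le_of_norm_fderiv_le
      (fun z _ => hdiff z) hbound (left_mem_segment ℝ _ _) (right_mem_segment ℝ _ _)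
    rw [iteratedFDeriv_eq_zero_of_one_le_norm hv hv0 (by omega) hy.ge, sub_zero,
      norm_sub_inv_norm_smul_self hx0 hx1] at hmv
    calc _ ≤ η * ε ^ j * (1 - ‖x‖) := hmv
      _ ≤ η * ε ^ j * ε := by
        have := hε.1
        gcongr
        linarith
      _ = η * ε ^ (j + 1) := by ring

/-- If `v` is a `C^n` function on `ℝᵐ` vanishing outside the open unit ball,
and `χ_ε` (for `ε ∈ (0,1)`) are smooth cutoffs with `0 ≤ χ_ε ≤ 1`, vanishing
on `{|x| ≤ 1 − ε}`, whose `k`-th derivatives are bounded by `C · ε^{−k}` for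
`k ≤ n`, then the `C^n` norm of `χ_ε · v` on the closed unit ball tends to `0`
as `ε → 0⁺`. -/
theorem cutoff_product_small {m n : ℕ} (hm : 1 ≤ m)
    (v : EuclideanSpace ℝ (Fin m) → ℝ) (hv : ContDiff ℝ n v)
    (hv0 : ∀ x ∉ Metric.ball (0 : EuclideanSpace ℝ (Fin m)) 1, v x = 0)
    (χ : ℝ → EuclideanSpace ℝ (Fin m) → ℝ)
    (hχsmooth : ∀ ε ∈ Set.Ioo (0 : ℝ) 1, ContDiff ℝ (⊤ : ℕ∞) (χ ε))
    (hχ01 : ∀ ε ∈ Set.Ioo (0 : ℝ) 1, ∀ x, 0 ≤ χ ε x ∧ χ ε x ≤ 1)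
    (hχ0 : ∀ ε ∈ Set.Ioo (0 : ℝ) 1, ∀ x : EuclideanSpace ℝ (Fin m),
      ‖x‖ ≤ 1 - ε → χ ε x = 0)
    (C : ℝ) (hC : 0 < C)
    (hχbound : ∀ ε ∈ Set.Ioo (0 : ℝ) 1, ∀ x, ∀ k ≤ n,
      ‖iteratedFDeriv ℝ k (χ ε) x‖ ≤ C * ε ^ (-(k : ℤ))) :
    ∀ δ > (0 : ℝ), ∃ ε₀ ∈ Set.Ioo (0 : ℝ) 1, ∀ ε, 0 < ε → ε < ε₀ →
      ∀ x ∈ Metric.closedBall (0 : EuclideanSpace ℝ (Fin m)) 1, ∀ k ≤ n,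
        ‖iteratedFDeriv ℝ k (fun y => χ ε y * v y) x‖ < δ := by
  intro δ hδ
  have hη : 0 < δ / (2 * 2 ^ n * C) := by positivity
  set η := δ / (2 * 2 ^ n * C) with hηdef
  obtain ⟨ε₀, hε₀, hnear⟩ := exists_norm_iteratedFDeriv_le_near_sphere hv hv0 hη
  refine ⟨ε₀, hε₀, fun ε hε hεlt x hx k hk => ?_⟩
  have hεI : ε ∈ Set.Ioo (0 : ℝ) 1 := ⟨hε, hεlt.trans hε₀.2⟩
  have hx1 : ‖x‖ ≤ 1 := mem_closedBall_zero_iff.1 hx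
  rcases lt_or_ge ‖x‖ (1 - ε) with hlt | hge
  · have hev : (fun y => χ ε y * v y) =ᶠ[nhds x] fun _ => 0 := by
      filter_upwards [(isOpen_lt continuous_norm continuous_const).mem_nhds hlt] with y hy
      rw [hχ0 ε hεI y hy.le, zero_mul]
    have h0 := (hev.iteratedFDeriv ℝ k).eq_of_nhds
    simp only [iteratedFDeriv_fun_zero, Pi.zero_apply] at h0
    simpa [h0] using hδ
  have hsmall := norm_iteratedFDeriv_le_mul_pow_on_annulus hv hv0 hη.le hεI
    (fun y hy _ => hnear y (by linarith))
  have hχk : ContDiff ℝ n (χ ε) := (hχsmooth ε hεI).of_le (by exact_mod_cast le_top)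
  calc ‖iteratedFDeriv ℝ k (fun y => χ ε y * v y) x‖
      ≤ ∑ i ∈ Finset.range (k + 1), (k.choose i : ℝ) * ‖iteratedFDeriv ℝ i (χ ε) x‖ *
          ‖iteratedFDeriv ℝ (k - i) v x‖ :=
        norm_iteratedFDeriv_mul_le hχk hv x (by exact_mod_cast hk)
    _ ≤ ∑ i ∈ Finset.range (k + 1), (k.choose i : ℝ) * (C * η) := by
        refine Finset.sum_le_sum fun i hi => ?_
        have hik : i ≤ k := Finset.mem_range_succ_iff.1 hi
        rw [mul_assoc]
        refine mul_le_mul_of_nonneg_left ?_ (Nat.cast_nonneg _)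
        calc ‖iteratedFDeriv ℝ i (χ ε) x‖ * ‖iteratedFDeriv ℝ (k - i) v x‖
            ≤ (C * ε ^ (-(i : ℤ))) * (η * ε ^ (n - k + i)) := by
              gcongr
              · exact hχbound ε hεI x i (hik.trans hk)
              · exact hsmall (n - k + i) (k - i) (by omega) x hge hx1
          _ = C * η * ε ^ (n - k) := by
              rw [zpow_neg, zpow_natCast, pow_add]
              field_simp
          _ ≤ C * η :=
              mul_le_of_le_one_right (by positivity) (pow_le_one₀ hε.le hεI.2.le)
    _ = 2 ^ k * (C * η) := by
        rw [← Finset.sum_mul]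
        exact_mod_cast congrArg (fun N : ℕ => (N : ℝ) * (C * η)) (Nat.sum_range_choose k)
    _ ≤ 2 ^ n * (C * η) := by
        gcongr
        norm_num
    _ = δ / 2 := by
        rw [hηdef]
        field_simp
    _ < δ := half_lt_self hδ
end

section
/- Let X be a topological space, Y a second-countable topological space, and f : X → Y an arbitrary (not necessarily continuous) function. Suppose that for every open set W ⊆ Y and every point y ∈ W there exists a subset T ⊆ W such that y lies in the interior of T and f⁻¹(T) is closed in X. Then for every open set W ⊆ Y the preimage f⁻¹(W) is an F_σ subset of X, i.e., f is F_σ-measurable. -/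
/-- If `Y` is second countable and `f : X → Y` is a (not necessarily
continuous) function such that every point `y` of every open set `W ⊆ Y`
admits a subset `T ⊆ W` with `y ∈ interior T` and `f ⁻¹' T` closed, then `f`
is `F_σ`-measurable: the preimage of every open set is a countable union of
closed sets. -/
theorem fSigmaMeasurable_of_local {X Y : Type*} [TopologicalSpace X]
    [TopologicalSpace Y] [SecondCountableTopology Y] (f : X → Y)
    (hloc : ∀ W : Set Y, IsOpen W → ∀ y ∈ W, ∃ T ⊆ W,
      y ∈ interior T ∧ IsClosed (f ⁻¹' T)) :
    ∀ W : Set Y, IsOpen W → ∃ F : ℕ → Set X,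
      (∀ n, IsClosed (F n)) ∧ f ⁻¹' W = ⋃ n, F n := by
  intro W hW
  choose T hTW hT hclosed using fun y : W => hloc W hW y y.2
  obtain ⟨S, hS, hcover⟩ := TopologicalSpace.isOpen_iUnion_countable
    (fun y : W => interior (T y)) fun _ => isOpen_interior
  have hW_eq : W = ⋃ y ∈ S, T y := by
    refine Set.Subset.antisymm (fun y hy => ?_) (Set.iUnion₂_subset fun y _ => hTW y)
    have hy' : y ∈ ⋃ z ∈ S, interior (T z) :=
      hcover ▸ Set.mem_iUnion_of_mem (⟨y, hy⟩ : W) (hT ⟨y, hy⟩)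
    exact Set.iUnion₂_mono (fun z _ => interior_subset) hy'
  rcases S.eq_empty_or_nonempty with rfl | hne
  · refine ⟨fun _ => ∅, fun _ => isClosed_empty, ?_⟩
    rw [hW_eq]
    simp
  · obtain ⟨g, rfl⟩ := hS.exists_eq_range hne
    refine ⟨fun n => f ⁻¹' T (g n), fun n => hclosed (g n), ?_⟩
    conv_lhs => rw [hW_eq]
    rw [Set.biUnion_range, Set.preimage_iUnion]
end

section
/- If (X_n)_{n∈ℕ} is a sequence of nonempty topological spaces none of which is compact, then the product space Π_{n∈ℕ} X_n (with the product topology) is not σ-compact; that is, it is not the union of countably many compact subsets. -/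
/-- A countable product of nonempty, noncompact topological spaces is not
σ-compact. -/
theorem not_sigmaCompact_pi_of_noncompact (X : ℕ → Type*)
    [∀ n, TopologicalSpace (X n)] [∀ n, Nonempty (X n)]
    (hnc : ∀ n, ¬ IsCompact (Set.univ : Set (X n))) :
    ¬ IsSigmaCompact (Set.univ : Set (∀ n, X n)) := by
  rintro ⟨K, hK, hcover⟩
  have hproj (n : ℕ) : ∃ x : X n, x ∉ Function.eval n '' K n := by
    rw [← Set.ne_univ_iff_exists_notMem]
    intro h
    exact hnc n (h ▸ (hK n).image (continuous_apply n))
  choose x hx using hproj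
  obtain ⟨n, hn⟩ := Set.mem_iUnion.mp (hcover ▸ Set.mem_univ x)
  exact hx n (Set.mem_image_of_mem _ hn)
end

section
/- Let ℓ² denote the real Hilbert space of square-summable sequences ℕ → ℝ. The Hilbert cube in ℓ² is Q = {x ∈ ℓ² : |x n| ≤ 2^{−n} for all n}. Σ denotes the linear span of Q in ℓ². Then Σ (with the subspace topology inherited from ℓ²) is meager in itself: Σ is the union of the countably many sets m·Q (m ∈ ℕ), each of which is closed in Σ and has empty interior in Σ. -/
open Pointwise

/-- The Hilbert cube in `ℓ²`: sequences `x` with `|x n| ≤ 2⁻ⁿ` for all `n`. -/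
noncomputable def HilbertCubeL2 : Set (lp (fun _ : ℕ => ℝ) 2) :=
  {x | ∀ n : ℕ, |x n| ≤ (2 : ℝ) ^ (-(n : ℤ))}

theorem mem_natCast_smul_HilbertCubeL2_iff (m : ℕ) (x : lp (fun _ : ℕ => ℝ) 2) :
    x ∈ (m : ℝ) • HilbertCubeL2 ↔ ∀ n : ℕ, |x n| ≤ m * (2 : ℝ) ^ (-(n : ℤ)) := by
  rcases Nat.eq_zero_or_pos m with rfl | hm
  · have hne : HilbertCubeL2.Nonempty := ⟨0, fun n => by simp⟩
    rw [Nat.cast_zero, Set.zero_smul_set hne, Set.mem_zero]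
    refine ⟨fun h n => by simp [h], fun h => ?_⟩
    ext n
    simpa using h n
  · have hm' : (0 : ℝ) < m := Nat.cast_pos.mpr hm
    rw [Set.mem_smul_set_iff_inv_smul_mem₀ hm'.ne']
    refine forall_congr' fun n => ?_
    rw [lp.coeFn_smul, Pi.smul_apply, smul_eq_mul, abs_mul, abs_of_pos (inv_pos.mpr hm'),
      inv_mul_le_iff₀ hm']

theorem exists_mem_natCast_smul_HilbertCubeL2 {x : lp (fun _ : ℕ => ℝ) 2}
    (hx : x ∈ Submodule.span ℝ HilbertCubeL2) : ∃ m : ℕ, x ∈ (m : ℝ) • HilbertCubeL2 := by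
  induction hx using Submodule.span_induction with
  | mem x h => exact ⟨1, by simpa using h⟩
  | zero => exact ⟨0, (mem_natCast_smul_HilbertCubeL2_iff _ _).mpr fun n => by simp⟩
  | add x y _ _ hx hy =>
    obtain ⟨a, ha⟩ := hx
    obtain ⟨b, hb⟩ := hy
    rw [mem_natCast_smul_HilbertCubeL2_iff] at ha hb
    refine ⟨a + b, (mem_natCast_smul_HilbertCubeL2_iff _ _).mpr fun n => ?_⟩
    rw [lp.coeFn_add, Pi.add_apply, Nat.cast_add, add_mul]
    exact (abs_add_le _ _).trans (add_le_add (ha n) (hb n))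
  | smul c x _ hx =>
    obtain ⟨a, ha⟩ := hx
    obtain ⟨k, hk⟩ := exists_nat_ge |c|
    rw [mem_natCast_smul_HilbertCubeL2_iff] at ha
    refine ⟨k * a, (mem_natCast_smul_HilbertCubeL2_iff _ _).mpr fun n => ?_⟩
    rw [lp.coeFn_smul, Pi.smul_apply, smul_eq_mul, abs_mul, Nat.cast_mul, mul_assoc]
    exact mul_le_mul hk (ha n) (abs_nonneg _) (Nat.cast_nonneg _)

theorem isClosed_natCast_smul_HilbertCubeL2 (m : ℕ) :
    IsClosed ((m : ℝ) • HilbertCubeL2) := by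
  have hcoe : Continuous fun x : lp (fun _ : ℕ => ℝ) 2 => (x : ℕ → ℝ) :=
    lp.uniformContinuous_coe.continuous
  have h : (m : ℝ) • HilbertCubeL2 =
      ⋂ n : ℕ, {x : lp (fun _ : ℕ => ℝ) 2 | |x n| ≤ m * (2 : ℝ) ^ (-(n : ℤ))} := by
    ext x
    simp only [mem_natCast_smul_HilbertCubeL2_iff, Set.mem_iInter, Set.mem_ofPred_eq]
  rw [h]
  exact isClosed_iInter fun n =>
    isClosed_le ((continuous_apply n).comp hcoe).abs continuous_const

theorem lp_single_mem_span_HilbertCubeL2 (n : ℕ) (t : ℝ) :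
    (lp.single 2 n t : lp (fun _ : ℕ => ℝ) 2) ∈ Submodule.span ℝ HilbertCubeL2 := by
  have hpos : (0 : ℝ) < (2 : ℝ) ^ (-(n : ℤ)) := by positivity
  have hmem : (lp.single 2 n ((2 : ℝ) ^ (-(n : ℤ))) : lp (fun _ : ℕ => ℝ) 2) ∈
      HilbertCubeL2 := by
    intro k
    rcases eq_or_ne k n with rfl | hk
    · simp
    · rw [lp.single_apply_ne 2 n _ hk, abs_zero]
      positivity
  have h := Submodule.smul_mem _ (t / (2 : ℝ) ^ (-(n : ℤ))) (Submodule.subset_span hmem)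
  rwa [← lp.single_smul, smul_eq_mul, div_mul_cancel₀ _ hpos.ne'] at h

theorem interior_natCast_smul_HilbertCubeL2 (m : ℕ) :
    interior (Subtype.val ⁻¹' ((m : ℝ) • HilbertCubeL2) :
      Set (Submodule.span ℝ HilbertCubeL2)) = ∅ := by
  refine Set.eq_empty_of_forall_notMem fun x hx => ?_
  obtain ⟨ε, hε, hball⟩ := Metric.mem_nhds_iff.mp (mem_interior_iff_mem_nhds.mp hx)
  have hbound : ∀ n : ℕ, ε / 2 ≤ 2 * m * (1 / 2 : ℝ) ^ n := by
    intro n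
    let e : Submodule.span ℝ HilbertCubeL2 := ⟨_, lp_single_mem_span_HilbertCubeL2 n (ε / 2)⟩
    have hnorm : ‖e‖ = ε / 2 := by
      change ‖(lp.single 2 n (ε / 2) : lp (fun _ : ℕ => ℝ) 2)‖ = ε / 2
      rw [lp.norm_single (by norm_num), Real.norm_of_nonneg (half_pos hε).le]
    have hxe : x + e ∈ Metric.ball x ε := by
      rw [mem_ball_iff_norm, add_sub_cancel_left, hnorm]
      exact half_lt_self hε
    have h₁ := (mem_natCast_smul_HilbertCubeL2_iff m _).mp (hball hxe) n
    have h₂ := (mem_natCast_smul_HilbertCubeL2_iff m _).mp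
      (hball (Metric.mem_ball_self hε)) n
    have hval : ((x + e : Submodule.span ℝ HilbertCubeL2) : lp (fun _ : ℕ => ℝ) 2) n =
        (x : lp (fun _ : ℕ => ℝ) 2) n + ε / 2 := by
      simp [e]
    rw [hval] at h₁
    have hpow : (2 : ℝ) ^ (-(n : ℤ)) = (1 / 2 : ℝ) ^ n := by simp
    rw [hpow] at h₁ h₂
    linarith [(abs_le.mp h₁).2, (abs_le.mp h₂).1]
  have hlim : Filter.Tendsto (fun n : ℕ => 2 * (m : ℝ) * (1 / 2 : ℝ) ^ n)
      Filter.atTop (nhds 0) := by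
    simpa using (tendsto_pow_atTop_nhds_zero_of_lt_one (r := (1 / 2 : ℝ))
      (by norm_num) (by norm_num)).const_mul (2 * (m : ℝ))
  exact (half_pos hε).not_ge (ge_of_tendsto' hlim hbound)

/-- The linear span `Σ` of the Hilbert cube (with its subspace topology from
`ℓ²`) is meager in itself: it is the union of the countably many sets `m • Q`,
each of which is closed in `Σ` and has empty interior in `Σ`. -/
theorem span_hilbertCube_meager_in_itself :
    (⋃ m : ℕ, (Subtype.val ⁻¹' ((m : ℝ) • HilbertCubeL2) :
        Set (Submodule.span ℝ HilbertCubeL2)) = Set.univ) ∧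
      (∀ m : ℕ, IsClosed (Subtype.val ⁻¹' ((m : ℝ) • HilbertCubeL2) :
        Set (Submodule.span ℝ HilbertCubeL2))) ∧
      (∀ m : ℕ, interior (Subtype.val ⁻¹' ((m : ℝ) • HilbertCubeL2) :
        Set (Submodule.span ℝ HilbertCubeL2)) = ∅) := by
  refine ⟨Set.eq_univ_of_forall fun x => ?_, fun m => ?_, interior_natCast_smul_HilbertCubeL2⟩
  · exact Set.mem_iUnion.mpr (exists_mem_natCast_smul_HilbertCubeL2 x.2)
  · exact (isClosed_natCast_smul_HilbertCubeL2 m).preimage continuous_subtype_val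
end
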